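/- Let Q be a finite quiver having at least one end: there is a vertex v incident to at least one arrow such that v is a sink (no arrow has tail v) or a source (no arrow has head v). Let n ≥ 1. Then for every additive representation x : Q_A → Matrix(n,n,ℂ) all of whose matrices x(a) are invertible, the orbit of x under the gauge action of ∏_{v∈Q_V} GL(n,ℂ) is not closed in the space of additive representations Q_A → Matrix(n,n,ℂ) with the product topology. In other words, no invertible additive representation of a quiver with ends has a closed gauge orbit. -/

import Mathlib

open Matrix
open scoped MatrixGroups

/-- The orbit of an additive quiver representation `x : Q_A → Matrix(n,n,ℂ)` under the
gauge action of `∏_{v ∈ Q_V} GL(n,ℂ)`, `(g·x)(a) = g(h(a))·x(a)·g(t(a))⁻¹`. -/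
def glGaugeOrbit {V A : Type*} (hd tl : A → V) (n : ℕ)
    (x : A → Matrix (Fin n) (Fin n) ℂ) : Set (A → Matrix (Fin n) (Fin n) ℂ) :=
  {y | ∃ g : V → GL (Fin n) ℂ, ∀ a,
    y a = (g (hd a) : Matrix (Fin n) (Fin n) ℂ) * x a *
      (((g (tl a))⁻¹ : GL (Fin n) ℂ) : Matrix (Fin n) (Fin n) ℂ)}

/-- The scalar matrix `u • 1` as an element of `GL(n,ℂ)`. -/
def scalarGL (n : ℕ) (u : ℂˣ) : GL (Fin n) ℂ :=
  Units.map (algebraMap ℂ (Matrix (Fin n) (Fin n) ℂ) : ℂ →* Matrix (Fin n) (Fin n) ℂ) u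

theorem scalarGL_mul (n : ℕ) (u : ℂˣ) (M : Matrix (Fin n) (Fin n) ℂ) :
    (scalarGL n u : Matrix (Fin n) (Fin n) ℂ) * M = (u : ℂ) • M := by
  simp [scalarGL, Algebra.smul_def]

theorem mul_scalarGL_inv (n : ℕ) (u : ℂˣ) (M : Matrix (Fin n) (Fin n) ℂ) :
    M * (((scalarGL n u)⁻¹ : GL (Fin n) ℂ) : Matrix (Fin n) (Fin n) ℂ) = (u : ℂ)⁻¹ • M := by
  rw [scalarGL, ← map_inv, Units.coe_map, ← Units.val_inv_eq_inv_val, Algebra.smul_def]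
  exact (Algebra.commutes _ _).symm

/-- Every member of the orbit of an invertible representation is invertible. -/
theorem isUnit_of_mem_glGaugeOrbit {V A : Type*} {hd tl : A → V} {n : ℕ}
    {x y : A → Matrix (Fin n) (Fin n) ℂ} (hx : ∀ a, IsUnit (x a))
    (hy : y ∈ glGaugeOrbit hd tl n x) (a : A) : IsUnit (y a) := by
  obtain ⟨g, hg⟩ := hy
  rw [hg a]
  exact ((g (hd a)).isUnit.mul (hx a)).mul (g (tl a))⁻¹.isUnit

open Classical in
/-- Rescaling all arrows at an end by a nonzero scalar stays in the gauge orbit. -/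
theorem smul_end_mem_glGaugeOrbit {V A : Type*} (hd tl : A → V) (n : ℕ) {v : V}
    (hv : (∀ a, tl a ≠ v) ∨ (∀ a, hd a ≠ v)) (x : A → Matrix (Fin n) (Fin n) ℂ)
    {t : ℂ} (ht : t ≠ 0) :
    (fun a => (if hd a = v ∨ tl a = v then t else 1) • x a) ∈ glGaugeOrbit hd tl n x := by
  rcases hv with hv | hv
  · refine ⟨fun w => if w = v then scalarGL n (Units.mk0 t ht) else 1, fun a => ?_⟩
    by_cases h : hd a = v <;> simp [h, hv a, scalarGL_mul]
  · refine ⟨fun w => if w = v then scalarGL n (Units.mk0 t ht)⁻¹ else 1, fun a => ?_⟩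
    by_cases h : tl a = v
    · simp [h, hv a, mul_scalarGL_inv, -coe_units_inv]
    · simp [h, hv a]

/-- If a finite quiver has an end (a vertex incident to at least one arrow
which is a sink or a source), then no invertible additive representation has a closed
gauge orbit in the space of additive representations. -/
theorem stmt_12 {V A : Type*} [Fintype V] [Fintype A] (hd tl : A → V) (n : ℕ) (hn : 1 ≤ n)
    (hend : ∃ v : V, (∃ a, hd a = v ∨ tl a = v) ∧
      ((∀ a, tl a ≠ v) ∨ (∀ a, hd a ≠ v)))
    (x : A → Matrix (Fin n) (Fin n) ℂ) (hx : ∀ a, IsUnit (x a)) :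
    ¬ IsClosed (glGaugeOrbit hd tl n x) := by
  classical
  intro hclosed
  obtain ⟨v, ⟨a, ha⟩, hv⟩ := hend
  have : Nonempty (Fin n) := ⟨⟨0, hn⟩⟩
  let c : ℂ → A → Matrix (Fin n) (Fin n) ℂ :=
    fun t a => (if hd a = v ∨ tl a = v then t else 1) • x a
  have hc : Continuous c := by
    refine continuous_pi fun b => ?_
    by_cases h : hd b = v ∨ tl b = v
    · simp only [c, if_pos h]
      fun_prop
    · simpa only [c, if_neg h] using continuous_const
  have hmem : (0 : ℂ) ∈ c ⁻¹' glGaugeOrbit hd tl n x :=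
    closure_minimal (fun t ht => smul_end_mem_glGaugeOrbit hd tl n hv x ht)
      (hclosed.preimage hc) (dense_compl_singleton (0 : ℂ) 0)
  have hunit : IsUnit (c 0 a) := isUnit_of_mem_glGaugeOrbit hx hmem a
  simp only [c, if_pos ha, zero_smul] at hunit
  exact not_isUnit_zero hunit
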